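/- Let p be a strictly monotone lattice norm on ℝ² with p((1,0)) = p((0,1)) = 1, let Φ be an Orlicz function, and let x, y ∈ L^Φ(μ) satisfy 0 ≤ x ≤ y μ-a.e. and ‖y‖_{Φ,p} = 1. Then ‖y − x‖_{Φ,p} ≤ 1 − δ_{m,p}(I_Φ(x)), where δ_{m,p} is the modulus of monotonicity of (ℝ², p). -/

import Mathlib

open MeasureTheory Filter

noncomputable section

/-- The Orlicz modular `I_Φ(x) = ∫ Φ(x t) dμ` (valued in `[0,∞]`). -/
def Iphi {Ω : Type*} [MeasurableSpace Ω] (μ : Measure Ω) (Φ : ℝ → ℝ) (x : Ω → ℝ) : ENNReal :=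
  ∫⁻ t, ENNReal.ofReal (Φ (x t)) ∂μ

/-- One term `(1/k)·p((1, I_Φ(kx)))` of the defining infimum; value `∞` if `I_Φ(kx) = ∞`. -/
def aTerm {Ω : Type*} [MeasurableSpace Ω] (μ : Measure Ω) (Φ : ℝ → ℝ) (p : ℝ × ℝ → ℝ)
    (x : Ω → ℝ) (k : ℝ) : ENNReal :=
  if Iphi μ Φ (fun t => k * x t) = ⊤ then ⊤
  else ENNReal.ofReal ((1 / k) * p (1, (Iphi μ Φ (fun t => k * x t)).toReal))

/-- The norm `‖x‖_{Φ,p} = inf_{k>0} (1/k)·p((1, I_Φ(kx)))`. -/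
def aNorm {Ω : Type*} [MeasurableSpace Ω] (μ : Measure Ω) (Φ : ℝ → ℝ) (p : ℝ × ℝ → ℝ)
    (x : Ω → ℝ) : ENNReal :=
  ⨅ (k : ℝ) (_ : 0 < k), aTerm μ Φ p x k

/-- `Φ` is an Orlicz function: convex, even, vanishing at `0`, nonnegative, not identically `0`. -/
def IsOrlicz (Φ : ℝ → ℝ) : Prop :=
  ConvexOn ℝ Set.univ Φ ∧ (∀ u, Φ (-u) = Φ u) ∧ Φ 0 = 0 ∧ (∀ u, 0 ≤ Φ u) ∧ ∃ u, Φ u ≠ 0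

/-- `p` is a lattice norm on `ℝ²`: a norm which is monotone with respect to the
coordinatewise order on absolute values. -/
def IsLatticeNorm (p : ℝ × ℝ → ℝ) : Prop :=
  (∀ a b : ℝ × ℝ, p (a + b) ≤ p a + p b) ∧ (∀ (c : ℝ) (a : ℝ × ℝ), p (c • a) = |c| * p a) ∧
  (∀ a : ℝ × ℝ, p a = 0 → a = 0) ∧
  (∀ a b : ℝ × ℝ, |a.1| ≤ |b.1| → |a.2| ≤ |b.2| → p a ≤ p b)

/-- `p` is strictly monotone: `0 ≤ a ≤ b` coordinatewise and `a ≠ b` imply `p a < p b`. -/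
def StrictMonoNorm (p : ℝ × ℝ → ℝ) : Prop :=
  ∀ a b : ℝ × ℝ, 0 ≤ a.1 → 0 ≤ a.2 → a.1 ≤ b.1 → a.2 ≤ b.2 → a ≠ b → p a < p b

/-- Membership in the Orlicz space `L^Φ(μ)`. -/
def MemLphi {Ω : Type*} [MeasurableSpace Ω] (μ : Measure Ω) (Φ : ℝ → ℝ) (x : Ω → ℝ) : Prop :=
  Measurable x ∧ ∃ l : ℝ, 0 < l ∧ Iphi μ Φ (fun t => l * x t) ≠ ⊤

/-- Membership in the space `E^Φ(μ)` of order continuous elements. -/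
def MemEphi {Ω : Type*} [MeasurableSpace Ω] (μ : Measure Ω) (Φ : ℝ → ℝ) (x : Ω → ℝ) : Prop :=
  Measurable x ∧ ∀ l : ℝ, 0 < l → Iphi μ Φ (fun t => l * x t) ≠ ⊤

/-- `a(Φ) = sup{u ≥ 0 : Φ(u) = 0}`. -/
def aPhi (Φ : ℝ → ℝ) : ℝ := sSup {u : ℝ | 0 ≤ u ∧ Φ u = 0}

/-- `K(x) = {k > 0 : ‖x‖_{Φ,p} = (1/k)·p((1, I_Φ(kx)))}`. -/
def Kset {Ω : Type*} [MeasurableSpace Ω] (μ : Measure Ω) (Φ : ℝ → ℝ) (p : ℝ × ℝ → ℝ)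
    (x : Ω → ℝ) : Set ℝ :=
  {k : ℝ | 0 < k ∧ aNorm μ Φ p x = aTerm μ Φ p x k}

/-- Condition `Δ₂(ℝ₊)`: `Φ(2u) ≤ K·Φ(u)` for all `u ≥ 0`. -/
def Delta2 (Φ : ℝ → ℝ) : Prop := ∃ K : ℝ, 0 < K ∧ ∀ u : ℝ, 0 ≤ u → Φ (2 * u) ≤ K * Φ u

/-- A non-atomic measure: every set of positive measure has a measurable subset of
strictly smaller positive measure. -/
def NonAtomic {Ω : Type*} [MeasurableSpace Ω] (μ : Measure Ω) : Prop :=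
  ∀ A : Set Ω, MeasurableSet A → 0 < μ A →
    ∃ B ⊆ A, MeasurableSet B ∧ 0 < μ B ∧ μ B < μ A

/-- The modulus of monotonicity of `(ℝ², p)`:
`δ_{m,p}(ε) = inf{1 − p(b − a) : 0 ≤ a ≤ b coordinatewise, p a ≥ ε, p b = 1}`. -/
def deltaM (p : ℝ × ℝ → ℝ) (ε : ℝ) : ℝ :=
  sInf {d : ℝ | ∃ a b : ℝ × ℝ, 0 ≤ a.1 ∧ 0 ≤ a.2 ∧ a.1 ≤ b.1 ∧ a.2 ≤ b.2 ∧
    ε ≤ p a ∧ p b = 1 ∧ d = 1 - p (b - a)}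

theorem IsOrlicz.map_mul_le {Φ : ℝ → ℝ} (hΦ : IsOrlicz Φ) {t : ℝ} (ht0 : 0 ≤ t) (ht1 : t ≤ 1)
    (u : ℝ) : Φ (t * u) ≤ t * Φ u := by
  have h := hΦ.1.2 (Set.mem_univ u) (Set.mem_univ (0 : ℝ)) ht0 (sub_nonneg.2 ht1) (by ring)
  simpa [hΦ.2.2.1] using h

theorem IsOrlicz.continuous {Φ : ℝ → ℝ} (hΦ : IsOrlicz Φ) : Continuous Φ :=
  continuousOn_univ.1 (hΦ.1.continuousOn isOpen_univ)

theorem IsOrlicz.map_sub_add_le {Φ : ℝ → ℝ} (hΦ : IsOrlicz Φ) {u v : ℝ} (hu : 0 ≤ u)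
    (huv : u ≤ v) : Φ (v - u) + Φ u ≤ Φ v := by
  rcases (hu.trans huv).eq_or_lt with hv | hv
  · obtain rfl : u = 0 := le_antisymm (hv ▸ huv) hu
    simp [hΦ.2.2.1]
  · have h1 := hΦ.map_mul_le (div_nonneg hu hv.le) ((div_le_one hv).2 huv) v
    have h2 := hΦ.map_mul_le (t := (v - u) / v) (div_nonneg (sub_nonneg.2 huv) hv.le)
      ((div_le_one hv).2 (by linarith)) v
    rw [div_mul_cancel₀ _ hv.ne'] at h1 h2
    have h3 : (v - u) / v * Φ v + u / v * Φ v = Φ v := by field_simp; ring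
    linarith

theorem IsLatticeNorm.apply_le_add {p : ℝ × ℝ → ℝ} (hp : IsLatticeNorm p) (h10 : p (1, 0) = 1)
    (h01 : p (0, 1) = 1) (a : ℝ × ℝ) : p a ≤ |a.1| + |a.2| := by
  have h := hp.1 (a.1 • ((1 : ℝ), (0 : ℝ))) (a.2 • ((0 : ℝ), (1 : ℝ)))
  rw [hp.2.1, hp.2.1, h10, h01] at h
  simpa using h

theorem IsLatticeNorm.continuous {p : ℝ × ℝ → ℝ} (hp : IsLatticeNorm p) (h10 : p (1, 0) = 1)
    (h01 : p (0, 1) = 1) : Continuous p := by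
  have key : ∀ a b : ℝ × ℝ, p a ≤ p b + 2 * dist a b := by
    intro a b
    have h1 := hp.1 b (a - b)
    have h2 := hp.apply_le_add h10 h01 (a - b)
    have h3 : |(a - b).1| ≤ dist a b := by
      rw [dist_eq_norm]; exact norm_fst_le (a - b)
    have h4 : |(a - b).2| ≤ dist a b := by
      rw [dist_eq_norm]; exact norm_snd_le (a - b)
    rw [add_sub_cancel] at h1
    linarith
  exact (LipschitzWith.of_le_add_mul 2 (by simpa using key)).continuous

theorem IsLatticeNorm.abs_fst_le {p : ℝ × ℝ → ℝ} (hp : IsLatticeNorm p) (h10 : p (1, 0) = 1)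
    (a : ℝ × ℝ) : |a.1| ≤ p a := by
  have h := hp.2.1 a.1 (1, 0)
  rw [h10, mul_one] at h
  rw [← h]
  exact hp.2.2.2 _ _ (by simp) (by simp)

theorem IsLatticeNorm.abs_snd_le {p : ℝ × ℝ → ℝ} (hp : IsLatticeNorm p) (h01 : p (0, 1) = 1)
    (a : ℝ × ℝ) : |a.2| ≤ p a := by
  have h := hp.2.1 a.2 (0, 1)
  rw [h01, mul_one] at h
  rw [← h]
  exact hp.2.2.2 _ _ (by simp) (by simp)

theorem deltaM_le {p : ℝ × ℝ → ℝ} (hp : IsLatticeNorm p) {ε : ℝ} {a b : ℝ × ℝ}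
    (ha1 : 0 ≤ a.1) (ha2 : 0 ≤ a.2) (h1 : a.1 ≤ b.1) (h2 : a.2 ≤ b.2) (ha : ε ≤ p a)
    (hb : p b = 1) : deltaM p ε ≤ 1 - p (b - a) := by
  refine csInf_le ⟨0, ?_⟩ ⟨a, b, ha1, ha2, h1, h2, ha, hb, rfl⟩
  rintro d ⟨a, b, ha1, ha2, h1, h2, -, hb, rfl⟩
  have : p (b - a) ≤ p b := hp.2.2.2 _ _
    (by rw [Prod.fst_sub, abs_of_nonneg (by linarith), abs_of_nonneg (by linarith)]; linarith)
    (by rw [Prod.snd_sub, abs_of_nonneg (by linarith), abs_of_nonneg (by linarith)]; linarith)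
  linarith

section Modular

variable {Ω : Type*} [MeasurableSpace Ω] {μ : Measure Ω} {Φ : ℝ → ℝ} {x y : Ω → ℝ}

theorem Iphi_sub_add_le (hΦ : IsOrlicz Φ) (hx : Measurable x)
    (hle : ∀ᵐ t ∂μ, 0 ≤ x t ∧ x t ≤ y t) {k : ℝ} (hk : 0 ≤ k) :
    Iphi μ Φ (fun t => k * (y t - x t)) + Iphi μ Φ (fun t => k * x t)
      ≤ Iphi μ Φ (fun t => k * y t) := by
  have hm : Measurable fun t => ENNReal.ofReal (Φ (k * x t)) :=
    (hΦ.continuous.measurable.comp (hx.const_mul k)).ennreal_ofReal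
  unfold Iphi
  rw [← lintegral_add_right _ hm]
  refine lintegral_mono_ae ?_
  filter_upwards [hle] with t ht
  rw [← ENNReal.ofReal_add (hΦ.2.2.2.1 _) (hΦ.2.2.2.1 _), mul_sub]
  exact ENNReal.ofReal_le_ofReal
    (hΦ.map_sub_add_le (mul_nonneg hk ht.1) (mul_le_mul_of_nonneg_left ht.2 hk))

theorem Iphi_min_mul_le (hΦ : IsOrlicz Φ) {k : ℝ} (hk : 0 < k) :
    Iphi μ Φ (fun t => min k 1 * x t)
      ≤ ENNReal.ofReal (1 / k) * Iphi μ Φ (fun t => k * x t) := by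
  unfold Iphi
  rw [← lintegral_const_mul' _ _ ENNReal.ofReal_ne_top]
  refine lintegral_mono fun t => ?_
  rw [← ENNReal.ofReal_mul (by positivity)]
  refine ENNReal.ofReal_le_ofReal ?_
  have h1 : min k 1 / k ≤ 1 := (div_le_one hk).2 (min_le_left _ _)
  have h2 : min k 1 / k ≤ 1 / k := div_le_div_of_nonneg_right (min_le_right _ _) hk.le
  have h := hΦ.map_mul_le (div_nonneg (le_min hk.le zero_le_one) hk.le) h1 (k * x t)
  rw [← mul_assoc, div_mul_cancel₀ _ hk.ne'] at h
  exact h.trans (mul_le_mul_of_nonneg_right h2 (hΦ.2.2.2.1 _))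

theorem Iphi_le_liminf (hΦ : IsOrlicz Φ) (hx : Measurable x) {m : ℕ → ℝ}
    (hm : Tendsto m atTop (nhds 1)) :
    Iphi μ Φ x ≤ liminf (fun n => Iphi μ Φ (fun t => m n * x t)) atTop := by
  have hmeas : ∀ n, Measurable fun t => ENNReal.ofReal (Φ (m n * x t)) := fun n =>
    (hΦ.continuous.measurable.comp (hx.const_mul _)).ennreal_ofReal
  refine le_trans (le_of_eq ?_) (lintegral_liminf_le hmeas)
  unfold Iphi
  refine lintegral_congr fun t => ?_
  have h : Tendsto (fun n => m n * x t) atTop (nhds (x t)) := by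
    simpa using hm.mul_const (x t)
  exact (ENNReal.tendsto_ofReal ((hΦ.continuous.tendsto _).comp h)).liminf_eq.symm

/-- A near-minimizer `k` of the norm of `y` yields the vectors `(1/k)(1, I_Φ(ky))` and
`(1/k)(0, I_Φ(kx))` of the plane, here written `(1/k, v)` and `(0, s)`. -/
theorem exists_near_minimizer (hΦ : IsOrlicz Φ) {p : ℝ × ℝ → ℝ} (hp : IsLatticeNorm p)
    (hx : Measurable x) (hle : ∀ᵐ t ∂μ, 0 ≤ x t ∧ x t ≤ y t) (hny : aNorm μ Φ p y = 1)
    {ε : ℝ} (hε : 0 < ε) :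
    ∃ k v s : ℝ, 0 < k ∧ 0 ≤ s ∧ s ≤ v ∧ 1 ≤ p (1 / k, v) ∧ p (1 / k, v) < 1 + ε ∧
      aNorm μ Φ p (fun t => y t - x t) ≤ ENNReal.ofReal (p (1 / k, v - s)) ∧
      Iphi μ Φ (fun t => min k 1 * x t) ≤ ENNReal.ofReal s := by
  have hscale : ∀ k c : ℝ, 0 < k → 1 / k * p (1, c) = p (1 / k, 1 / k * c) := by
    intro k c hk
    have h := hp.2.1 (1 / k) (1, c)
    rw [abs_of_pos (by positivity)] at h
    rw [← h]; simp
  have hlt : aNorm μ Φ p y < ENNReal.ofReal (1 + ε) := by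
    rw [hny, ← ENNReal.ofReal_one]
    exact (ENNReal.ofReal_lt_ofReal_iff (by linarith)).2 (by linarith)
  simp only [aNorm, iInf_lt_iff] at hlt
  obtain ⟨k, hk, hlt⟩ := hlt
  have hge : 1 ≤ aTerm μ Φ p y k := hny ▸ iInf₂_le k hk
  have hky : Iphi μ Φ (fun t => k * y t) ≠ ⊤ := by
    intro h
    rw [aTerm, if_pos h] at hlt
    exact not_top_lt hlt
  rw [aTerm, if_neg hky, hscale k _ hk] at hlt hge
  have hsum := Iphi_sub_add_le hΦ hx hle hk.le
  have hkx : Iphi μ Φ (fun t => k * x t) ≠ ⊤ :=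
    ne_top_of_le_ne_top hky (le_add_self.trans hsum)
  have hkd : Iphi μ Φ (fun t => k * (y t - x t)) ≠ ⊤ :=
    ne_top_of_le_ne_top hky (le_self_add.trans hsum)
  have hreal := ENNReal.toReal_mono hky hsum
  rw [ENNReal.toReal_add hkd hkx] at hreal
  have hd0 : 0 ≤ (Iphi μ Φ (fun t => k * (y t - x t))).toReal := ENNReal.toReal_nonneg
  have hk' : 0 < 1 / k := by positivity
  refine ⟨k, 1 / k * (Iphi μ Φ (fun t => k * y t)).toReal,
    1 / k * (Iphi μ Φ (fun t => k * x t)).toReal, hk,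
    mul_nonneg hk'.le ENNReal.toReal_nonneg, mul_le_mul_of_nonneg_left (by linarith) hk'.le,
    ENNReal.one_le_ofReal.1 hge, (ENNReal.ofReal_lt_ofReal_iff (by linarith)).1 hlt, ?_, ?_⟩
  · refine (iInf₂_le k hk).trans ?_
    rw [aTerm, if_neg hkd, hscale k _ hk, ← mul_sub]
    refine ENNReal.ofReal_le_ofReal (hp.2.2.2 _ _ le_rfl ?_)
    refine abs_le_abs_of_nonneg (mul_nonneg hk'.le hd0) ?_
    exact mul_le_mul_of_nonneg_left (by linarith) hk'.le
  · rw [ENNReal.ofReal_mul hk'.le, ENNReal.ofReal_toReal hkx]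
    exact Iphi_min_mul_le hΦ hk

end Modular

/-- If `p` is a strictly monotone lattice norm on `ℝ²` with `p (1,0) = p (0,1) = 1`, `Φ` is an
Orlicz function, and `x, y ∈ L^Φ(μ)` satisfy `0 ≤ x ≤ y` a.e. and `‖y‖_{Φ,p} = 1`, then
`‖y − x‖_{Φ,p} ≤ 1 − δ_{m,p}(I_Φ(x))`, where `δ_{m,p}` is the modulus of monotonicity
of `(ℝ², p)`. -/
theorem stmt10 {Ω : Type*} [MeasurableSpace Ω] (μ : Measure Ω) [SigmaFinite μ]
    (Φ : ℝ → ℝ) (hΦ : IsOrlicz Φ)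
    (p : ℝ × ℝ → ℝ) (hp : IsLatticeNorm p) (hpm : StrictMonoNorm p)
    (h10 : p (1, 0) = 1) (h01 : p (0, 1) = 1)
    (x y : Ω → ℝ) (hx : MemLphi μ Φ x) (hy : MemLphi μ Φ y)
    (hle : ∀ᵐ t ∂μ, 0 ≤ x t ∧ x t ≤ y t) (hny : aNorm μ Φ p y = 1) :
    aNorm μ Φ p (fun t => y t - x t)
      ≤ ENNReal.ofReal (1 - deltaM p ((Iphi μ Φ x).toReal)) := by
  have hlim : Tendsto (fun n : ℕ => 1 + 1 / ((n : ℝ) + 1)) atTop (nhds 1) := by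
    simpa using tendsto_one_div_add_atTop_nhds_zero_nat.const_add (1 : ℝ)
  choose k v s hk hs hsv hge hlt hnorm hFatou using fun n : ℕ =>
    exists_near_minimizer hΦ hp hx.1 hle hny (Nat.one_div_pos_of_nat (α := ℝ) (n := n))
  have hbound : ∀ n, p (1 / k n, v n) ≤ 2 := fun n => by
    have : 1 / ((n : ℝ) + 1) ≤ 1 := by
      rw [div_le_one (by positivity)]; linarith [n.cast_nonneg (α := ℝ)]
    linarith [hlt n]
  have hu0 : ∀ n, 0 < 1 / k n := fun n => one_div_pos.2 (hk n)
  have hu : ∀ n, 1 / k n ≤ p (1 / k n, v n) := fun n =>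
    (le_abs_self _).trans (hp.abs_fst_le h10 (1 / k n, v n))
  have hv : ∀ n, v n ≤ p (1 / k n, v n) := fun n =>
    (le_abs_self _).trans (hp.abs_snd_le h01 (1 / k n, v n))
  have hmem : ∀ n, (1 / k n, v n, s n) ∈
      Set.Icc (0 : ℝ) 2 ×ˢ Set.Icc (0 : ℝ) 2 ×ˢ Set.Icc (0 : ℝ) 2 := fun n =>
    ⟨⟨(hu0 n).le, (hu n).trans (hbound n)⟩,
      ⟨(hs n).trans (hsv n), (hv n).trans (hbound n)⟩,
      ⟨hs n, (hsv n).trans ((hv n).trans (hbound n))⟩⟩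
  obtain ⟨⟨u', v', s'⟩, hmem', φ, hφ, hconv⟩ :=
    (isCompact_Icc.prod (isCompact_Icc.prod isCompact_Icc)).tendsto_subseq hmem
  have hcu : Tendsto (fun n => 1 / k (φ n)) atTop (nhds u') :=
    (continuous_fst.tendsto _).comp hconv
  have hcv : Tendsto (fun n => v (φ n)) atTop (nhds v') :=
    (continuous_fst.tendsto _).comp ((continuous_snd.tendsto _).comp hconv)
  have hcs : Tendsto (fun n => s (φ n)) atTop (nhds s') :=
    (continuous_snd.tendsto _).comp ((continuous_snd.tendsto _).comp hconv)
  have hpc := hp.continuous h10 h01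
  have hb : p (u', v') = 1 := by
    have h1 := (hpc.tendsto (u', v')).comp (hcu.prodMk_nhds hcv)
    exact tendsto_nhds_unique h1 (tendsto_of_tendsto_of_tendsto_of_le_of_le tendsto_const_nhds
      (hlim.comp hφ.tendsto_atTop) (fun n => hge _) (fun n => (hlt _).le))
  have hm : Tendsto (fun n => min (k n) 1) atTop (nhds 1) := by
    have hinv := hlim.inv₀ one_ne_zero
    rw [inv_one] at hinv
    refine tendsto_of_tendsto_of_tendsto_of_le_of_le hinv tendsto_const_nhds (fun n => ?_)
      (fun n => min_le_right _ _)
    have hpos : (0 : ℝ) < 1 / ((n : ℝ) + 1) := Nat.one_div_pos_of_nat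
    refine le_min ?_ (inv_le_one_of_one_le₀ (by linarith))
    refine inv_le_of_inv_le₀ (hk n) ?_
    rw [← one_div]
    exact (hu n).trans (hlt n).le
  have hI : Iphi μ Φ x ≤ ENNReal.ofReal s' := by
    refine (Iphi_le_liminf hΦ hx.1 (hm.comp hφ.tendsto_atTop)).trans ?_
    refine (liminf_le_liminf (Eventually.of_forall fun n => hFatou (φ n))).trans ?_
    exact (ENNReal.tendsto_ofReal hcs).liminf_eq.le
  have hs0 : 0 ≤ s' := hmem'.2.2.1
  have hps : s' ≤ p (0, s') := (le_abs_self _).trans (hp.abs_snd_le h01 (0, s'))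
  have hdelta := deltaM_le hp (a := (0, s')) (b := (u', v')) le_rfl hs0 hmem'.1.1
    (le_of_tendsto_of_tendsto' hcs hcv fun n => hsv _)
    ((ENNReal.toReal_le_of_le_ofReal hs0 hI).trans hps) hb
  have hfin : aNorm μ Φ p (fun t => y t - x t) ≤ ENNReal.ofReal (p (u', v' - s')) :=
    ge_of_tendsto' (ENNReal.tendsto_ofReal
      ((hpc.tendsto (u', v' - s')).comp (hcu.prodMk_nhds (hcv.sub hcs)))) fun n => hnorm _
  refine hfin.trans (ENNReal.ofReal_le_ofReal ?_)
  rw [Prod.mk_sub_mk, sub_zero] at hdelta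
  linarith
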